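/- Let n ≥ 2, let e ∈ ℝ^n be a nonzero vector, and let v ∈ C^{1,1}(ℝ) be bounded. Define v_e : ℝ^n → ℝ by v_e(x) = v(e·x). Then 𝓘_n[v_e](x) = |e| · C_n · 𝓘_1[v](e·x) for all x ∈ ℝ^n, where C_n = ∫_{ℝ^{n-1}} (|y|² + 1)^{-(n+1)/2} dy. Equivalently, |e| C_n 𝓘_1[v](ξ) = P.V. ∫_{ℝ^n} (v(ξ + e·z) − v(ξ)) |z|^{-(n+1)} dz for all ξ ∈ ℝ. -/

import Mathlib

open MeasureTheory
open scoped RealInnerProductSpace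

/-- The operator `𝓘_n`, written (for bounded `C^{1,1}` functions) in its
absolutely convergent split form, which agrees with the principal value
`P.V. ∫_{ℝ^n} (u(x+y) − u(x)) |y|^{-(n+1)} dy`. -/
noncomputable def Iop (n : ℕ) (u : EuclideanSpace ℝ (Fin n) → ℝ)
    (x : EuclideanSpace ℝ (Fin n)) : ℝ :=
  (∫ y in {y : EuclideanSpace ℝ (Fin n) | ‖y‖ < 1},
      (u (x + y) - u x - fderiv ℝ u x y) * ‖y‖ ^ (-((n : ℝ) + 1))) +
  ∫ y in {y : EuclideanSpace ℝ (Fin n) | 1 < ‖y‖},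
      (u (x + y) - u x) * ‖y‖ ^ (-((n : ℝ) + 1))

/-- The one-dimensional operator `𝓘_1` in its split form. -/
noncomputable def Iop1 (v : ℝ → ℝ) (ξ : ℝ) : ℝ :=
  (∫ y in {y : ℝ | |y| < 1}, (v (ξ + y) - v ξ - deriv v ξ * y) * |y| ^ (-(2 : ℝ))) +
  ∫ y in {y : ℝ | 1 < |y|}, (v (ξ + y) - v ξ) * |y| ^ (-(2 : ℝ))

lemma abs_sub_sub_deriv_mul_le {v : ℝ → ℝ} (hv : Differentiable ℝ v) {K : NNReal}
    (hlip : LipschitzWith K (deriv v)) (ξ t : ℝ) :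
    |v (ξ + t) - v ξ - deriv v ξ * t| ≤ K * t ^ 2 := by
  have key := (convex_uIcc (0 : ℝ) t).norm_image_sub_le_of_norm_hasDerivWithin_le
    (f := fun s => v (ξ + s) - deriv v ξ * s) (f' := fun s => deriv v (ξ + s) - deriv v ξ)
    (C := K * |t|) (x := 0) (y := t) (fun s _ => by
      have h1 : HasDerivAt (fun s => v (ξ + s)) (deriv v (ξ + s)) s :=
        (hv (ξ + s)).hasDerivAt.comp_const_add ξ s
      have h2 : HasDerivAt (fun s => deriv v ξ * s) (deriv v ξ) s := by
        simpa using (hasDerivAt_id s).const_mul (deriv v ξ)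
      exact (h1.sub h2).hasDerivWithinAt)
    (fun s hs => by
      have h := hlip.dist_le_mul (ξ + s) ξ
      rw [dist_eq_norm, dist_eq_norm] at h
      refine h.trans ?_
      have hs' : |s| ≤ |t| := by simpa using Set.abs_sub_left_of_mem_uIcc hs
      rw [add_sub_cancel_left, Real.norm_eq_abs]
      gcongr)
    Set.left_mem_uIcc Set.right_mem_uIcc
  simp only [Real.norm_eq_abs, add_zero, mul_zero, sub_zero] at key
  rw [mul_assoc, abs_mul_abs_self, ← pow_two] at key
  convert key using 2
  ring

section Symmetrization

variable {E : Type*} [NormedAddCommGroup E] [InnerProductSpace ℝ E] [FiniteDimensional ℝ E]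
  [MeasurableSpace E] [BorelSpace E]

lemma integrableOn_near [Nontrivial E] {v : ℝ → ℝ} (hv : Differentiable ℝ v) {K : NNReal}
    (hlip : LipschitzWith K (deriv v)) (e : E) (ξ : ℝ) :
    IntegrableOn (fun y : E => (v (ξ + ⟪e, y⟫) - v ξ - deriv v ξ * ⟪e, y⟫) *
      ‖y‖ ^ (-((Module.finrank ℝ E : ℝ) + 1))) {y | ‖y‖ < 1} := by
  have hvm : Measurable v := hv.continuous.measurable
  have hs : {y : E | ‖y‖ < 1} = Metric.ball 0 1 := by ext; simp
  rw [hs]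
  refine integrableOn_ball_of_norm_le_rpow (C := K * ‖e‖ ^ 2)
    (α := (Module.finrank ℝ E : ℝ) - 1) Module.finrank_pos (by linarith)
    (Filter.Eventually.of_forall fun y => ?_) (by
      apply Measurable.aestronglyMeasurable
      fun_prop)
  rcases eq_or_ne y 0 with rfl | hy
  · simp only [inner_zero_right, add_zero, sub_self, mul_zero, zero_mul, norm_zero]
    positivity
  have hy' : 0 < ‖y‖ := norm_pos_iff.2 hy
  have hpow : ‖y‖ ^ (-((Module.finrank ℝ E : ℝ) - 1))
      = ‖y‖ ^ 2 * ‖y‖ ^ (-((Module.finrank ℝ E : ℝ) + 1)) := by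
    rw [← Real.rpow_natCast, ← Real.rpow_add hy']
    congr 1
    push_cast
    ring
  have hin : ⟪e, y⟫ ^ 2 ≤ ‖e‖ ^ 2 * ‖y‖ ^ 2 := by
    rw [← mul_pow]
    exact sq_le_sq' (neg_le_of_abs_le (abs_real_inner_le_norm e y)) (real_inner_le_norm e y)
  rw [hpow, norm_mul, Real.norm_eq_abs, Real.norm_of_nonneg (by positivity), ← mul_assoc]
  gcongr
  calc _ ≤ K * ⟪e, y⟫ ^ 2 := abs_sub_sub_deriv_mul_le hv hlip ξ _
    _ ≤ K * (‖e‖ ^ 2 * ‖y‖ ^ 2) := by gcongr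
    _ = _ := by ring

lemma integrableOn_far {v : ℝ → ℝ} (hv : Measurable v) {M : ℝ} (hbd : ∀ ξ, |v ξ| ≤ M)
    (e : E) (ξ : ℝ) :
    IntegrableOn (fun y : E => (v (ξ + ⟪e, y⟫) - v ξ) *
      ‖y‖ ^ (-((Module.finrank ℝ E : ℝ) + 1))) {y | 1 < ‖y‖} := by
  have hs : MeasurableSet {y : E | 1 < ‖y‖} := measurableSet_lt measurable_const measurable_norm
  have hint := ((integrable_one_add_norm (E := E) (μ := volume)
    (r := (Module.finrank ℝ E : ℝ) + 1) (by linarith)).const_mul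
      (2 * M * 2 ^ ((Module.finrank ℝ E : ℝ) + 1))).integrableOn (s := {y : E | 1 < ‖y‖})
  refine Integrable.mono' hint (by
    apply Measurable.aestronglyMeasurable
    fun_prop) ((ae_restrict_iff' hs).2 (Filter.Eventually.of_forall fun y (hy : 1 < ‖y‖) => ?_))
  rw [norm_mul, Real.norm_eq_abs, Real.norm_of_nonneg (by positivity), mul_assoc]
  have hM : |v (ξ + ⟪e, y⟫) - v ξ| ≤ 2 * M :=
    (abs_sub _ _).trans (by linarith [hbd (ξ + ⟪e, y⟫), hbd ξ])
  have hpow : ‖y‖ ^ (-((Module.finrank ℝ E : ℝ) + 1)) ≤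
      2 ^ ((Module.finrank ℝ E : ℝ) + 1) * (1 + ‖y‖) ^ (-((Module.finrank ℝ E : ℝ) + 1)) := by
    calc _ ≤ ((1 + ‖y‖) / 2) ^ (-((Module.finrank ℝ E : ℝ) + 1)) :=
          Real.rpow_le_rpow_of_nonpos (by positivity) (by linarith) (by linarith)
      _ = _ := by
          rw [Real.div_rpow (by positivity) (by positivity), Real.rpow_neg zero_le_two,
            div_inv_eq_mul, mul_comm]
  exact mul_le_mul hM hpow (by positivity) ((abs_nonneg _).trans hM)

/-- The split form of the operator applied to a ridge function is half the integral of the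
second-order difference, which converges absolutely. -/
lemma integrable_secondDiff_and_split_eq [Nontrivial E] {v : ℝ → ℝ} (hv : Differentiable ℝ v)
    {K : NNReal} (hlip : LipschitzWith K (deriv v)) {M : ℝ} (hbd : ∀ ξ, |v ξ| ≤ M) (e : E) (ξ : ℝ) :
    Integrable (fun y : E => (v (ξ + ⟪e, y⟫) + v (ξ - ⟪e, y⟫) - 2 * v ξ) *
      ‖y‖ ^ (-((Module.finrank ℝ E : ℝ) + 1))) ∧
    (∫ y in {y : E | ‖y‖ < 1}, (v (ξ + ⟪e, y⟫) - v ξ - deriv v ξ * ⟪e, y⟫) *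
      ‖y‖ ^ (-((Module.finrank ℝ E : ℝ) + 1))) +
    (∫ y in {y : E | 1 < ‖y‖}, (v (ξ + ⟪e, y⟫) - v ξ) *
      ‖y‖ ^ (-((Module.finrank ℝ E : ℝ) + 1))) =
    2⁻¹ * ∫ y : E, (v (ξ + ⟪e, y⟫) + v (ξ - ⟪e, y⟫) - 2 * v ξ) *
      ‖y‖ ^ (-((Module.finrank ℝ E : ℝ) + 1)) := by
  have hs₁ : MeasurableSet {y : E | ‖y‖ < 1} := measurableSet_lt measurable_norm measurable_const
  have hs₂ : MeasurableSet {y : E | 1 < ‖y‖} := measurableSet_lt measurable_const measurable_norm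
  have h₁ := (integrable_indicator_iff hs₁).2 (integrableOn_near hv hlip e ξ)
  have h₂ := (integrable_indicator_iff hs₂).2 (integrableOn_far hv.continuous.measurable hbd e ξ)
  rw [← integral_indicator hs₁, ← integral_indicator hs₂, ← integral_add h₁ h₂]
  have h := h₁.add h₂
  set F : E → ℝ := fun y => _ + _ with hF
  change Integrable F at h
  have hae : (fun y => F y + F (-y)) =ᵐ[volume] fun y : E =>
      (v (ξ + ⟪e, y⟫) + v (ξ - ⟪e, y⟫) - 2 * v ξ) *
      ‖y‖ ^ (-((Module.finrank ℝ E : ℝ) + 1)) := by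
    have hsph : ∀ᵐ y : E, y ∉ Metric.sphere (0 : E) 1 :=
      measure_eq_zero_iff_ae_notMem.1 (Measure.addHaar_sphere volume 0 1)
    filter_upwards [hsph] with y hy
    have hy1 : ‖y‖ ≠ 1 := by simpa using hy
    simp only [hF, Set.indicator, Set.mem_ofPred_eq, norm_neg, inner_neg_right]
    rcases lt_or_gt_of_ne hy1 with h | h
    · simp only [h, h.not_gt, if_true, if_false]
      ring_nf
    · simp only [h, h.not_gt, if_true, if_false]
      ring_nf
  refine ⟨(h.add h.comp_neg).congr hae, ?_⟩
  rw [← integral_congr_ae hae, integral_add h h.comp_neg, integral_neg_eq_self F volume]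
  ring

end Symmetrization

lemma integral_sq_add_norm_sq_rpow (m : ℕ) {s : ℝ} (hs : s ≠ 0) :
    ∫ z : EuclideanSpace ℝ (Fin m), (s ^ 2 + ‖z‖ ^ 2) ^ (-((m : ℝ) + 2) / 2) =
      |s| ^ (-(2 : ℝ)) * ∫ z : EuclideanSpace ℝ (Fin m), (‖z‖ ^ 2 + 1) ^ (-((m : ℝ) + 2) / 2) := by
  have hs' : 0 < |s| := abs_pos.2 hs
  have h := Measure.integral_comp_smul (volume : Measure (EuclideanSpace ℝ (Fin m)))
    (fun z => (s ^ 2 + ‖z‖ ^ 2) ^ (-((m : ℝ) + 2) / 2)) |s|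
  rw [finrank_euclideanSpace_fin, smul_eq_mul, abs_of_pos (inv_pos.2 (pow_pos hs' m))] at h
  have h2 : ∀ z : EuclideanSpace ℝ (Fin m),
      (s ^ 2 + ‖|s| • z‖ ^ 2) ^ (-((m : ℝ) + 2) / 2) =
        |s| ^ (-((m : ℝ) + 2)) * (‖z‖ ^ 2 + 1) ^ (-((m : ℝ) + 2) / 2) := fun z => by
    have : s ^ 2 + ‖|s| • z‖ ^ 2 = |s| ^ (2 : ℝ) * (‖z‖ ^ 2 + 1) := by
      rw [norm_smul, Real.norm_eq_abs, abs_abs, mul_pow, Real.rpow_two, sq_abs]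
      ring
    rw [this, Real.mul_rpow (by positivity) (by positivity), ← Real.rpow_mul hs'.le]
    congr 2
    ring
  simp only [h2, integral_const_mul] at h
  have h3 : |s| ^ (-(2 : ℝ)) = |s| ^ m * |s| ^ (-((m : ℝ) + 2)) := by
    rw [← Real.rpow_natCast, ← Real.rpow_add hs']
    congr 1
    ring
  rw [h3, mul_assoc, h, mul_inv_cancel_left₀ (by positivity)]

lemma exists_linearIsometryEquiv_apply_eq {E F : Type*} [NormedAddCommGroup E]
    [InnerProductSpace ℝ E] [FiniteDimensional ℝ E] [NormedAddCommGroup F] [InnerProductSpace ℝ F]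
    [FiniteDimensional ℝ F] (h : Module.finrank ℝ E = Module.finrank ℝ F) {a : E} {b : F}
    (hab : ‖a‖ = ‖b‖) : ∃ T : E ≃ₗᵢ[ℝ] F, T a = b := by
  let S : E ≃ₗᵢ[ℝ] F := (stdOrthonormalBasis ℝ E).equiv (stdOrthonormalBasis ℝ F) (finCongr h)
  refine ⟨S.trans (Submodule.reflection (Submodule.span ℝ {S a - b})ᗮ), ?_⟩
  exact Submodule.reflection_sub (by rw [S.norm_map, hab])

lemma integral_ridge_mul_norm_rpow (m : ℕ) (e : EuclideanSpace ℝ (Fin (m + 1))) (he : e ≠ 0)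
    (g : ℝ → ℝ)
    (hg : Integrable fun y : EuclideanSpace ℝ (Fin (m + 1)) => g ⟪e, y⟫ * ‖y‖ ^ (-((m : ℝ) + 2))) :
    ∫ y : EuclideanSpace ℝ (Fin (m + 1)), g ⟪e, y⟫ * ‖y‖ ^ (-((m : ℝ) + 2)) =
      ‖e‖ * (∫ z : EuclideanSpace ℝ (Fin m), (‖z‖ ^ 2 + 1) ^ (-((m : ℝ) + 2) / 2)) *
        ∫ t, g t * |t| ^ (-(2 : ℝ)) := by
  have he' : 0 < ‖e‖ := norm_pos_iff.2 he
  let a : WithLp 2 (ℝ × EuclideanSpace ℝ (Fin m)) := WithLp.toLp 2 (‖e‖, 0)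
  have hrank : Module.finrank ℝ (WithLp 2 (ℝ × EuclideanSpace ℝ (Fin m))) =
      Module.finrank ℝ (EuclideanSpace ℝ (Fin (m + 1))) := by
    rw [(WithLp.linearEquiv 2 ℝ (ℝ × EuclideanSpace ℝ (Fin m))).finrank_eq]
    simp [add_comm]
  obtain ⟨T, hT⟩ := exists_linearIsometryEquiv_apply_eq hrank (a := a) (b := e)
    (by simp [a])
  have hmp : MeasurePreserving
      (fun p : ℝ × EuclideanSpace ℝ (Fin m) => T (WithLp.toLp 2 p)) volume volume :=
    T.measurePreserving.comp (WithLp.volume_preserving_toLp _ _)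
  have hemb : MeasurableEmbedding
      (fun p : ℝ × EuclideanSpace ℝ (Fin m) => T (WithLp.toLp 2 p)) :=
    T.toHomeomorph.measurableEmbedding.comp (MeasurableEquiv.toLp 2 _).measurableEmbedding
  have hcomp : ∀ p : ℝ × EuclideanSpace ℝ (Fin m),
      g ⟪e, T (WithLp.toLp 2 p)⟫ * ‖T (WithLp.toLp 2 p)‖ ^ (-((m : ℝ) + 2)) =
        g (‖e‖ * p.1) * (p.1 ^ 2 + ‖p.2‖ ^ 2) ^ (-((m : ℝ) + 2) / 2) := fun p => by
    have hin : ⟪e, T (WithLp.toLp 2 p)⟫ = ‖e‖ * p.1 := by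
      rw [← hT, T.inner_map_map, T.norm_map]
      simp [a, mul_comm]
    rw [hin, T.norm_map, WithLp.prod_norm_eq_of_L2, Real.sqrt_eq_rpow,
      ← Real.rpow_mul (by positivity)]
    simp only [Real.norm_eq_abs, sq_abs]
    congr 2
    ring
  rw [← hmp.integral_comp hemb]
  have hg' := (hmp.integrable_comp_emb hemb).2 hg
  simp only [Function.comp_def, hcomp] at hg' ⊢
  rw [Measure.volume_eq_prod] at hg' ⊢
  rw [integral_prod _ hg']
  simp only [integral_const_mul]
  have hscale := Measure.integral_comp_mul_left (fun t => g t * |t| ^ (-(2 : ℝ))) ‖e‖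
  set C := ∫ z : EuclideanSpace ℝ (Fin m), (‖z‖ ^ 2 + 1) ^ (-((m : ℝ) + 2) / 2) with hC
  have hae : (fun s => g (‖e‖ * s) *
      ∫ z : EuclideanSpace ℝ (Fin m), (s ^ 2 + ‖z‖ ^ 2) ^ (-((m : ℝ) + 2) / 2)) =ᵐ[volume]
      fun s => (‖e‖ ^ 2 * C) * (g (‖e‖ * s) * |‖e‖ * s| ^ (-(2 : ℝ))) := by
    filter_upwards [Measure.ae_ne volume (0 : ℝ)] with s hs
    rw [integral_sq_add_norm_sq_rpow m hs, ← hC, abs_mul, abs_norm,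
      Real.mul_rpow he'.le (abs_nonneg s), Real.rpow_neg he'.le, Real.rpow_two]
    field_simp
  rw [integral_congr_ae hae, integral_const_mul, hscale, abs_of_pos (by positivity), smul_eq_mul]
  field_simp

/-- For `n ≥ 2`, `e ∈ ℝ^n` nonzero, and `v ∈ C^{1,1}(ℝ)` bounded, the function
`v_e(x) = v(e·x)` satisfies `𝓘_n[v_e](x) = |e| C_n 𝓘_1[v](e·x)`, where
`C_n = ∫_{ℝ^{n-1}} (|y|²+1)^{-(n+1)/2} dy`. -/
theorem stmt_3 (n : ℕ) (hn : 2 ≤ n) (e : EuclideanSpace ℝ (Fin n)) (he : e ≠ 0)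
    (v : ℝ → ℝ) (hv : ContDiff ℝ 1 v) (K : NNReal)
    (hlip : LipschitzWith K (deriv v)) (M : ℝ) (hbd : ∀ ξ, |v ξ| ≤ M)
    (Cn : ℝ)
    (hCn : Cn = ∫ y : EuclideanSpace ℝ (Fin (n - 1)),
      (‖y‖ ^ 2 + 1) ^ (-((n : ℝ) + 1) / 2)) :
    ∀ x : EuclideanSpace ℝ (Fin n),
      Iop n (fun z => v ⟪e, z⟫) x = ‖e‖ * Cn * Iop1 v ⟪e, x⟫ := by
  intro x
  obtain ⟨m, rfl⟩ : ∃ m, n = m + 1 := ⟨n - 1, by omega⟩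
  have hd : Differentiable ℝ v := hv.differentiable one_ne_zero
  have hfd : ∀ y, fderiv ℝ (fun z => v ⟪e, z⟫) x y = deriv v ⟪e, x⟫ * ⟪e, y⟫ := fun y => by
    have h := (hd ⟪e, x⟫).hasDerivAt.comp_hasFDerivAt x (innerSL ℝ e).hasFDerivAt
    have h' : fderiv ℝ (fun z => v ⟪e, z⟫) x = deriv v ⟪e, x⟫ • innerSL ℝ e := h.fderiv
    rw [h']
    simp
  obtain ⟨hint, hn_split⟩ := integrable_secondDiff_and_split_eq hd hlip hbd e ⟪e, x⟫
  have h1_split := (integrable_secondDiff_and_split_eq hd hlip hbd (1 : ℝ) ⟪e, x⟫).2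
  have hexp : -(((m + 1 : ℕ) : ℝ) + 1) = -((m : ℝ) + 2) := by
    push_cast
    ring
  have hexp1 : -((1 : ℕ) + 1 : ℝ) = -2 := by norm_num
  rw [finrank_euclideanSpace_fin, hexp] at hint hn_split
  simp only [Module.finrank_self, hexp1, Real.norm_eq_abs, RCLike.inner_apply,
    map_one, mul_one] at h1_split
  have hC : Cn = ∫ z : EuclideanSpace ℝ (Fin m), (‖z‖ ^ 2 + 1) ^ (-((m : ℝ) + 2) / 2) := by
    rw [← hexp]
    exact hCn
  rw [Iop, Iop1]
  simp only [inner_add_right, hfd]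
  rw [hexp, hn_split, h1_split, integral_ridge_mul_norm_rpow m e he
    (fun t => v (⟪e, x⟫ + t) + v (⟪e, x⟫ - t) - 2 * v ⟪e, x⟫) hint, ← hC]
  ring
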